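/- Let d ≥ 1 be an integer and let R = ℂ[x_{i,j} : 1 ≤ i ≤ d, j ∈ ℕ]. If I and J are GL(∞)-stable ideals of R whose intersections with the polynomial subring ℂ[x_{i,j} : 1 ≤ i ≤ d, 0 ≤ j < d] are equal, then I = J. (Contraction of GL(∞)-stable ideals of Sym(U ⊗ ℂ^∞) to ideals of Sym(U ⊗ ℂ^d), where d = dim U, is injective.) -/

import Mathlib

/-- The substitution endomorphism of `R = ℂ[x_{i,j} : 1 ≤ i ≤ d, j ∈ ℕ]` attached to an
invertible `n × n` matrix `g`: it sends `x_{i,j}` to `∑_{j' < n} g_{j',j} x_{i,j'}` for `j < n`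
and fixes `x_{i,j}` for `j ≥ n`. -/
noncomputable def glSubst (d n : ℕ) (g : GL (Fin n) ℂ) :
    MvPolynomial (Fin d × ℕ) ℂ →ₐ[ℂ] MvPolynomial (Fin d × ℕ) ℂ :=
  MvPolynomial.aeval fun p =>
    if h : p.2 < n then
      ∑ j' : Fin n, ((g : Matrix (Fin n) (Fin n) ℂ) j' ⟨p.2, h⟩) •
        MvPolynomial.X (p.1, (j' : ℕ))
    else MvPolynomial.X p

/-- An ideal of `R = ℂ[x_{i,j} : 1 ≤ i ≤ d, j ∈ ℕ]` is `GL(∞)`-stable if it is mapped into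
itself by all the substitution automorphisms. -/
def GLStable (d : ℕ) (I : Ideal (MvPolynomial (Fin d × ℕ) ℂ)) : Prop :=
  ∀ (n : ℕ) (g : GL (Fin n) ℂ) (f : MvPolynomial (Fin d × ℕ) ℂ), f ∈ I → glSubst d n g f ∈ I

open MvPolynomial Kronecker

section LinearSubstitution

variable {σ : Type*} [Fintype σ]

/-- The substitution `X p ↦ ∑ q, A q p • X q` attached to a square matrix `A`. -/
noncomputable def linSubst (A : Matrix σ σ ℂ) : MvPolynomial σ ℂ →ₐ[ℂ] MvPolynomial σ ℂ :=
  aeval fun p => ∑ q, A q p • X q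

theorem linSubst_X (A : Matrix σ σ ℂ) (p : σ) : linSubst A (X p) = ∑ q, A q p • X q := by
  simp [linSubst]

theorem totalDegree_linSubst_le (A : Matrix σ σ ℂ) (f : MvPolynomial σ ℂ) :
    (linSubst A f).totalDegree ≤ f.totalDegree := by
  conv_lhs => rw [f.as_sum, map_sum]
  refine totalDegree_finsetSum_le fun m hm => ?_
  rw [linSubst, aeval_monomial, algebraMap_eq]
  refine (totalDegree_mul _ _).trans ?_
  rw [totalDegree_C, zero_add]
  refine le_trans ?_ (le_totalDegree hm)
  refine (totalDegree_finsetProd _ _).trans (Finset.sum_le_sum fun p _ => ?_)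
  refine (totalDegree_pow _ _).trans ?_
  refine (Nat.mul_le_mul_left _ (?_ : _ ≤ 1)).trans (mul_one _).le
  exact totalDegree_finsetSum_le fun q _ => (totalDegree_smul_le _ _).trans (totalDegree_X q).le

theorem pderiv_linSubst (A : Matrix σ σ ℂ) (p : σ) (f : MvPolynomial σ ℂ) :
    pderiv p (linSubst A f) = ∑ q, A p q • linSubst A (pderiv q f) := by
  classical
  induction f using MvPolynomial.induction_on with
  | C a => simp [linSubst]
  | add f g hf hg => simp [hf, hg, Finset.sum_add_distrib]
  | mul_X f r hf =>
    have hr : pderiv p (linSubst A (X r)) = C (A p r) := by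
      simp [linSubst_X, pderiv_X, Pi.single_apply, smul_eq_C_mul]
    have hq (q : σ) : A p q • linSubst A (pderiv q (f * X r)) =
        A p q • linSubst A (pderiv q f) * linSubst A (X r) +
          (if q = r then C (A p q) * linSubst A f else 0) := by
      rcases eq_or_ne q r with rfl | hqr
      · simp [smul_eq_C_mul]
        ring
      · simp [pderiv_X_of_ne hqr.symm, hqr, mul_comm]
    rw [map_mul, pderiv_mul, hf, hr, Finset.sum_congr rfl fun q _ => hq q, Finset.sum_add_distrib,
      Finset.sum_mul, Finset.sum_ite_eq' Finset.univ r, if_pos (Finset.mem_univ r), mul_comm (C _)]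

/-- A subspace containing `linSubst (A + s • B) f` for infinitely many scalars `s` also contains
`linSubst A f`. -/
theorem linSubst_mem_of_infinite (S : Submodule ℂ (MvPolynomial σ ℂ)) (f : MvPolynomial σ ℂ)
    (A B : Matrix σ σ ℂ) (h : {s : ℂ | linSubst (A + s • B) f ∈ S}.Infinite) :
    linSubst A f ∈ S := by
  by_contra hf
  obtain ⟨φ, hφ, hS⟩ := Submodule.exists_le_ker_of_notMem hf
  let P : Polynomial (MvPolynomial σ ℂ) := aeval (fun p =>
    ∑ q, (Polynomial.C (A q p • X q) + Polynomial.X * Polynomial.C (B q p • X q))) f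
  have hP (s : ℂ) : P.eval (C s) = linSubst (A + s • B) f := by
    refine DFunLike.congr_fun (?_ : (Polynomial.evalRingHom (C s)).comp
      (aeval fun p => ∑ q, (Polynomial.C (A q p • X q) +
        Polynomial.X * Polynomial.C (B q p • X q))).toRingHom =
      (linSubst (A + s • B)).toRingHom) f
    refine MvPolynomial.ringHom_ext (fun a => ?_) fun p => ?_
    · simp [linSubst, Polynomial.algebraMap_apply]
    · simp [linSubst, Polynomial.eval_finsetSum, add_smul, smul_eq_C_mul, mul_assoc]
  let Q : Polynomial ℂ :=
    ∑ k ∈ Finset.range (P.natDegree + 1), Polynomial.monomial k (φ (P.coeff k))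
  have hQ (s : ℂ) : Q.eval s = φ (linSubst (A + s • B) f) := by
    rw [← hP, Polynomial.eval_eq_sum_range (p := P), map_sum, Polynomial.eval_finsetSum]
    refine Finset.sum_congr rfl fun k _ => ?_
    rw [Polynomial.eval_monomial, ← C_pow, mul_comm (P.coeff k), ← smul_eq_C_mul, map_smul,
      smul_eq_mul, mul_comm]
  have hQ0 : Q = 0 := Q.eq_zero_of_infinite_isRoot <| h.mono fun s hs => by
    rw [Set.mem_ofPred_eq, Polynomial.IsRoot, hQ]
    exact hS hs
  have := hQ 0
  rw [hQ0, zero_smul, add_zero, Polynomial.eval_zero] at this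
  exact hφ this.symm

end LinearSubstitution

section FischerForm

variable {σ : Type*} [Fintype σ]

/-- The Fischer inner product, for which the monomials are orthogonal and `X^m` has square norm
`m!`. -/
noncomputable def fischer (f g : MvPolynomial σ ℂ) : ℂ :=
  ∑ m ∈ f.support, star (coeff m f) * (∏ q, (m q).factorial : ℕ) * coeff m g

theorem fischer_eq_sum {f : MvPolynomial σ ℂ} {s : Finset (σ →₀ ℕ)} (hs : f.support ⊆ s)
    (g : MvPolynomial σ ℂ) :
    fischer f g = ∑ m ∈ s, star (coeff m f) * (∏ q, (m q).factorial : ℕ) * coeff m g :=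
  Finset.sum_subset hs fun m _ hm => by simp [notMem_support_iff.mp hm]

theorem star_fischer (f g : MvPolynomial σ ℂ) : star (fischer g f) = fischer f g := by
  classical
  rw [fischer_eq_sum (Finset.subset_union_left (s₁ := g.support) (s₂ := f.support)),
    fischer_eq_sum (Finset.subset_union_right (s₁ := g.support) (s₂ := f.support)), star_sum]
  refine Finset.sum_congr rfl fun m _ => ?_
  simp only [star_mul', star_star, star_natCast]
  ring

theorem fischer_add_left (f g h : MvPolynomial σ ℂ) :
    fischer (f + g) h = fischer f h + fischer g h := by
  classical
  rw [fischer_eq_sum support_add, fischer_eq_sum (Finset.subset_union_left (s₂ := g.support)),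
    fischer_eq_sum (Finset.subset_union_right (s₁ := f.support)), ← Finset.sum_add_distrib]
  refine Finset.sum_congr rfl fun m _ => ?_
  rw [coeff_add, star_add]
  ring

theorem fischer_smul_left (a : ℂ) (f g : MvPolynomial σ ℂ) :
    fischer (a • f) g = star a * fischer f g := by
  rw [fischer_eq_sum (support_smul (a := a) (f := f)), fischer, Finset.mul_sum]
  refine Finset.sum_congr rfl fun m _ => ?_
  rw [coeff_smul, smul_eq_mul, star_mul']
  ring

theorem fischer_add_right (f g h : MvPolynomial σ ℂ) :
    fischer f (g + h) = fischer f g + fischer f h := by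
  simp [fischer, mul_add, Finset.sum_add_distrib]

theorem fischer_smul_right (a : ℂ) (f g : MvPolynomial σ ℂ) :
    fischer f (a • g) = a * fischer f g := by
  rw [fischer, fischer, Finset.mul_sum]
  refine Finset.sum_congr rfl fun m _ => ?_
  rw [coeff_smul, smul_eq_mul]
  ring

theorem fischer_self (f : MvPolynomial σ ℂ) : fischer f f =
    ((∑ m ∈ f.support, ‖coeff m f‖ ^ 2 * (∏ q, (m q).factorial : ℕ) : ℝ) : ℂ) := by
  rw [fischer, Complex.ofReal_sum]
  refine Finset.sum_congr rfl fun m _ => ?_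
  rw [mul_right_comm, Complex.star_def, Complex.conj_mul']
  push_cast
  rfl

theorem eq_zero_of_fischer_self_eq_zero {f : MvPolynomial σ ℂ} (h : fischer f f = 0) : f = 0 := by
  rw [fischer_self, Complex.ofReal_eq_zero,
    Finset.sum_eq_zero_iff_of_nonneg fun m _ => by positivity] at h
  by_contra hf
  obtain ⟨m, hm⟩ := Finset.nonempty_iff_ne_empty.mpr (mt support_eq_empty.mp hf)
  have hfac : ((∏ q, (m q).factorial : ℕ) : ℝ) ≠ 0 :=
    Nat.cast_ne_zero.mpr <| Finset.prod_ne_zero_iff.mpr fun q _ => Nat.factorial_ne_zero _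
  exact mul_ne_zero (pow_ne_zero 2 (norm_ne_zero_iff.mpr (mem_support_iff.mp hm))) hfac (h m hm)

theorem fischer_monomial (m : σ →₀ ℕ) (a : ℂ) (g : MvPolynomial σ ℂ) :
    fischer (monomial m a) g = star a * (∏ q, (m q).factorial : ℕ) * coeff m g := by
  classical
  rw [fischer_eq_sum support_monomial_subset, Finset.sum_singleton, coeff_monomial, if_pos rfl]

theorem fischer_mul_X (f g : MvPolynomial σ ℂ) (p : σ) :
    fischer (f * X p) g = fischer f (pderiv p g) := by
  classical
  induction f using MvPolynomial.induction_on' with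
  | add f₁ f₂ h₁ h₂ => rw [add_mul, fischer_add_left, fischer_add_left, h₁, h₂]
  | monomial m a =>
    have hfac : ∏ q, ((m + Finsupp.single p 1 : σ →₀ ℕ) q).factorial =
        (m p + 1) * ∏ q, (m q).factorial := by
      rw [← Finset.mul_prod_erase _ _ (Finset.mem_univ p),
        ← Finset.mul_prod_erase _ (fun q => (m q).factorial) (Finset.mem_univ p), ← mul_assoc,
        ← Nat.factorial_succ]
      congr 1
      · simp
      · refine Finset.prod_congr rfl fun q hq => ?_
        simp [(Finset.ne_of_mem_erase hq).symm]
    rw [X, monomial_mul, mul_one, fischer_monomial, fischer_monomial, coeff_pderiv, hfac]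
    push_cast
    ring

theorem fischer_sum_left {ι : Type*} (s : Finset ι) (f : ι → MvPolynomial σ ℂ)
    (g : MvPolynomial σ ℂ) : fischer (∑ i ∈ s, f i) g = ∑ i ∈ s, fischer (f i) g :=
  map_sum (AddMonoidHom.mk' (fischer · g) fun f₁ f₂ => fischer_add_left f₁ f₂ g) f s

theorem fischer_sum_right {ι : Type*} (s : Finset ι) (f : MvPolynomial σ ℂ)
    (g : ι → MvPolynomial σ ℂ) : fischer f (∑ i ∈ s, g i) = ∑ i ∈ s, fischer f (g i) :=
  map_sum (AddMonoidHom.mk' (fischer f) (fischer_add_right f)) g s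

theorem fischer_linSubst (A : Matrix σ σ ℂ) (f g : MvPolynomial σ ℂ) :
    fischer (linSubst A f) g = fischer f (linSubst A.conjTranspose g) := by
  induction f using MvPolynomial.induction_on generalizing g with
  | C a =>
    have h0 : coeff 0 (linSubst A.conjTranspose g) = coeff 0 g := by
      induction g using MvPolynomial.induction_on with
      | C b => simp [linSubst]
      | add g₁ g₂ h₁ h₂ => simp [h₁, h₂]
      | mul_X g r _ =>
        simp [← constantCoeff_eq, linSubst_X, smul_eq_C_mul]
    rw [show linSubst A (C a) = C a by simp [linSubst], ← monomial_zero', fischer_monomial,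
      fischer_monomial, h0]
  | add f₁ f₂ h₁ h₂ => rw [map_add, fischer_add_left, fischer_add_left, h₁, h₂]
  | mul_X f p hf =>
    rw [map_mul, linSubst_X, fischer_mul_X, pderiv_linSubst, Finset.mul_sum, fischer_sum_left,
      fischer_sum_right]
    refine Finset.sum_congr rfl fun q _ => ?_
    rw [mul_smul_comm, fischer_smul_left, fischer_smul_right, fischer_mul_X, hf,
      Matrix.conjTranspose_apply]

/-- The Fischer inner product as an inner product space core. -/
@[reducible]
noncomputable def fischerCore : InnerProductSpace.Core ℂ (MvPolynomial σ ℂ) where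
  inner := fischer
  conj_inner_symm f g := star_fischer f g
  re_inner_nonneg f := by
    change 0 ≤ (fischer f f).re
    rw [fischer_self, Complex.ofReal_re]
    positivity
  add_left := fischer_add_left
  smul_left f g a := fischer_smul_left a f g
  definite _ := eq_zero_of_fischer_self_eq_zero

theorem Submodule.exists_mem_forall_inner_sub_eq_zero {E : Type*} [NormedAddCommGroup E]
    [InnerProductSpace ℂ E] (M : Submodule ℂ E) [FiniteDimensional ℂ M] (x : E) :
    ∃ a ∈ M, ∀ m ∈ M, inner ℂ (x - a) m = 0 := by
  obtain ⟨a, ha, b, hb, rfl⟩ := M.exists_add_mem_mem_orthogonal x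
  refine ⟨a, ha, fun m hm => ?_⟩
  rw [add_sub_cancel_left]
  exact (M.mem_orthogonal' b).mp hb m hm

theorem exists_mem_fischer_orthogonal (M : Submodule ℂ (MvPolynomial σ ℂ)) [FiniteDimensional ℂ M]
    (f : MvPolynomial σ ℂ) : ∃ a ∈ M, ∀ m ∈ M, fischer (f - a) m = 0 :=
  let c : InnerProductSpace.Core ℂ (MvPolynomial σ ℂ) := fischerCore
  @Submodule.exists_mem_forall_inner_sub_eq_zero _ c.toNormedAddCommGroup
    (InnerProductSpace.ofCore c.toCore) M _ f

end FischerForm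

/-- Subspaces of `ℂ[x_{i,j} : i < d, j < n]` stable under all substitutions acting on the index
`j`, compared after the substitutions with values in `ℂ[x_{i,j} : i, j < d]`. -/
theorem le_of_stable_of_linSubst_mem {d n : ℕ} (hdn : d ≤ n)
    (S T : Submodule ℂ (MvPolynomial (Fin d × Fin n) ℂ))
    (hS : ∀ (G : Matrix (Fin n) (Fin n) ℂ), ∀ f ∈ S, linSubst (1 ⊗ₖ G) f ∈ S)
    (hT : ∀ (G : Matrix (Fin n) (Fin n) ℂ), ∀ f ∈ T, linSubst (1 ⊗ₖ G) f ∈ T)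
    (h : ∀ f ∈ S, f ∈ supported ℂ {p : Fin d × Fin n | (p.2 : ℕ) < d} → f ∈ T) : S ≤ T := by
  intro f hf
  let M := S ⊓ T ⊓ restrictTotalDegree (Fin d × Fin n) ℂ f.totalDegree
  have hM (G : Matrix (Fin n) (Fin n) ℂ) (m) (hm : m ∈ M) : linSubst (1 ⊗ₖ G) m ∈ M :=
    ⟨⟨hS G m hm.1.1, hT G m hm.1.2⟩, (mem_restrictTotalDegree _ _ _).mpr <|
      (totalDegree_linSubst_le _ _).trans <| (mem_restrictTotalDegree _ _ _).mp hm.2⟩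
  have : FiniteDimensional ℂ M := Submodule.finiteDimensional_of_le inf_le_right
  obtain ⟨a, ha, horth⟩ := exists_mem_fischer_orthogonal M f
  suffices hb : f - a = 0 by
    rw [sub_eq_zero.mp hb]
    exact ha.1.2
  have hbS : f - a ∈ S := S.sub_mem hf ha.1.1
  have hbdeg : (f - a).totalDegree ≤ f.totalDegree :=
    (mem_restrictTotalDegree _ _ _).mp <| Submodule.sub_mem _
      ((mem_restrictTotalDegree _ _ _).mpr le_rfl) ha.2
  refine MvPolynomial.funext fun c => ?_
  let G : Matrix (Fin n) (Fin n) ℂ := fun j' j => if h : (j' : ℕ) < d then c (⟨j', h⟩, j) else 0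
  have hsupp : linSubst (1 ⊗ₖ G) (f - a) ∈
      supported ℂ {p : Fin d × Fin n | (p.2 : ℕ) < d} := by
    rw [linSubst, aeval_def, eval₂_eq]
    refine Subalgebra.sum_mem _ fun m _ => Subalgebra.mul_mem _ (Subalgebra.algebraMap_mem _ _) <|
      Subalgebra.prod_mem _ fun p _ => Subalgebra.pow_mem _ (Subalgebra.sum_mem _ fun q _ => ?_) _
    by_cases hq : (q.2 : ℕ) < d
    · have hX : X q ∈ supported ℂ {p : Fin d × Fin n | (p.2 : ℕ) < d} := by
        rw [X_mem_supported]
        exact hq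
      exact Subalgebra.smul_mem _ hX _
    · have hG : G q.2 p.2 = 0 := dif_neg hq
      rw [show (1 ⊗ₖ G) q p = (1 : Matrix (Fin d) (Fin d) ℂ) q.1 p.1 * G q.2 p.2 from rfl, hG, mul_zero, zero_smul]
      exact Subalgebra.zero_mem _
  have hmem : linSubst (1 ⊗ₖ G) (f - a) ∈ M :=
    ⟨⟨hS G _ hbS, h _ (hS G _ hbS) hsupp⟩, (mem_restrictTotalDegree _ _ _).mpr <|
      (totalDegree_linSubst_le _ _).trans hbdeg⟩
  have hzero : linSubst (1 ⊗ₖ G) (f - a) = 0 := by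
    refine eq_zero_of_fischer_self_eq_zero ?_
    rw [fischer_linSubst, Matrix.conjTranspose_kronecker, Matrix.conjTranspose_one]
    exact horth _ (hM _ _ hmem)
  have heval (g : MvPolynomial (Fin d × Fin n) ℂ) :
      eval (fun p => if (p.1 : ℕ) = p.2 then 1 else 0) (linSubst (1 ⊗ₖ G) g) = eval c g := by
    induction g using MvPolynomial.induction_on with
    | C b => simp [linSubst]
    | add g₁ g₂ h₁ h₂ => simp [h₁, h₂]
    | mul_X g p hg =>
      rw [map_mul, map_mul, map_mul, hg, linSubst_X, map_sum, eval_X]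
      congr 1
      rw [Fintype.sum_eq_single (p.1, Fin.castLE hdn p.1)]
      · have hG : G (Fin.castLE hdn p.1) p.2 = c p := dif_pos p.1.isLt
        simp [hG]
      · rintro ⟨i, j⟩ hij
        by_cases hi : i = p.1
        · subst hi
          have : (p.1 : ℕ) ≠ j := fun hj => hij (by ext <;> simp [hj])
          simp [this]
        · obtain ⟨i', j'⟩ := p
          simp [Matrix.kroneckerMap_apply, Matrix.one_apply_ne hi]
  rw [← heval, hzero, map_zero, map_zero]

theorem GLStable.rename_linSubst_mem {d : ℕ} {I : Ideal (MvPolynomial (Fin d × ℕ) ℂ)}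
    (hI : GLStable d I) {n : ℕ} (G : Matrix (Fin n) (Fin n) ℂ)
    {f : MvPolynomial (Fin d × Fin n) ℂ} (hf : rename (Prod.map id Fin.val) f ∈ I) :
    rename (Prod.map id Fin.val) (linSubst (1 ⊗ₖ G) f) ∈ I := by
  have hinv (g : GL (Fin n) ℂ) : rename (Prod.map id Fin.val)
      (linSubst ((1 : Matrix (Fin d) (Fin d) ℂ) ⊗ₖ (g : Matrix (Fin n) (Fin n) ℂ)) f) =
      glSubst d n g (rename (Prod.map id Fin.val) f) := by
    refine DFunLike.congr_fun (?_ : (rename (Prod.map id Fin.val)).comp (linSubst _) =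
      (glSubst d n g).comp (rename (Prod.map id Fin.val))) f
    refine MvPolynomial.algHom_ext fun p => ?_
    simp [linSubst_X, glSubst, Fintype.sum_prod_type, Matrix.kroneckerMap_apply, Matrix.one_apply]
  refine linSubst_mem_of_infinite ((I.restrictScalars ℂ).comap
    (rename (Prod.map id Fin.val) :
      MvPolynomial (Fin d × Fin n) ℂ →ₐ[ℂ] MvPolynomial (Fin d × ℕ) ℂ).toLinearMap)
    f (1 ⊗ₖ G) (1 ⊗ₖ 1) ?_
  have hfin : {s : ℂ | (-G).charpoly.IsRoot s}.Finite :=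
    Polynomial.finite_setOfPred_isRoot (Matrix.charpoly_monic _).ne_zero
  refine hfin.infinite_compl.mono fun s hs => ?_
  have hdet : (G + s • (1 : Matrix (Fin n) (Fin n) ℂ)).det ≠ 0 := by
    intro h0
    refine hs ?_
    rw [Set.mem_ofPred_eq, Polynomial.IsRoot, Matrix.eval_charpoly, ← h0, sub_neg_eq_add, add_comm,
      Matrix.smul_one_eq_diagonal]
    rfl
  have hmem := hI n (Matrix.GeneralLinearGroup.mkOfDetNeZero _ hdet) _ hf
  rw [← hinv] at hmem
  rw [Set.mem_ofPred_eq, ← Matrix.kronecker_smul, ← Matrix.kronecker_add]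
  exact hmem

theorem GLStable.le_of_contraction_le {d : ℕ} {I J : Ideal (MvPolynomial (Fin d × ℕ) ℂ)}
    (hI : GLStable d I) (hJ : GLStable d J)
    (h : ∀ f ∈ supported ℂ {p : Fin d × ℕ | p.2 < d}, f ∈ I → f ∈ J) : I ≤ J := by
  intro f hf
  let n := max d (f.vars.sup Prod.snd + 1)
  let e : Fin d × Fin n → Fin d × ℕ := Prod.map id Fin.val
  have he : Function.Injective e := Function.injective_id.prodMap Fin.val_injective
  obtain ⟨f', hf'⟩ : ∃ f', rename e f' = f := by
    refine exists_rename_eq_of_vars_subset_range f e he fun p hp => ?_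
    have hlt : p.2 < n := lt_max_of_lt_right (Nat.lt_succ_of_le (Finset.le_sup (f := Prod.snd) hp))
    exact ⟨(p.1, ⟨p.2, hlt⟩), rfl⟩
  let pull (K : Ideal (MvPolynomial (Fin d × ℕ) ℂ)) :
      Submodule ℂ (MvPolynomial (Fin d × Fin n) ℂ) :=
    (K.restrictScalars ℂ).comap (rename e).toLinearMap
  rw [← hf'] at hf ⊢
  refine le_of_stable_of_linSubst_mem (le_max_left _ _) (pull I) (pull J)
    (fun G _ hg => hI.rename_linSubst_mem G hg) (fun G _ hg => hJ.rename_linSubst_mem G hg)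
    (fun g hg hsupp => h _ ?_ hg) hf
  rw [mem_supported] at hsupp ⊢
  intro p hp
  obtain ⟨q, hq, rfl⟩ := Finset.mem_image.mp (vars_rename e g hp)
  exact hsupp hq

/-- Contraction of `GL(∞)`-stable ideals of `Sym(U ⊗ ℂ^∞) = ℂ[x_{i,j} : 1 ≤ i ≤ d, j ∈ ℕ]`
to ideals of `Sym(U ⊗ ℂ^d) = ℂ[x_{i,j} : 1 ≤ i ≤ d, 0 ≤ j < d]` is injective:
two `GL(∞)`-stable ideals with the same intersection with the subring in the variables
`x_{i,j}`, `j < d`, are equal. -/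
theorem glStable_ideal_eq_of_contraction_eq (d : ℕ) (hd : 1 ≤ d)
    (I J : Ideal (MvPolynomial (Fin d × ℕ) ℂ))
    (hI : GLStable d I) (hJ : GLStable d J)
    (h : ∀ f ∈ MvPolynomial.supported ℂ {p : Fin d × ℕ | p.2 < d}, f ∈ I ↔ f ∈ J) :
    I = J := by
  exact le_antisymm (hI.le_of_contraction_le hJ fun f hf => (h f hf).mp)
    (hJ.le_of_contraction_le hI fun f hf => (h f hf).mpr)
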